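/- Let 0<ε<1/2. There exists a constant C>0 (depending only on ε) such that for all real k≠0 and l with 2|k| < |k−l| (which forces |k−l|/2 ≤ |l| ≤ 2|k−l|): |k−l|^{-1/2} ≤ ⟨1/(k−l)⟩^{1/2} ≤ C ⟨1/l⟩^{ε} ⟨1/(k−l)⟩^{ε} ( 1 + ⟨1/k⟩^{1/2−2ε} ), where ⟨1/a⟩ = (1+a^{-2})^{1/2}. -/

import Mathlib

open MeasureTheory Real

noncomputable section

/-- Japanese bracket `⟨a⟩ = (1+a²)^{1/2}`. -/
def jap (a : ℝ) : ℝ := Real.sqrt (1 + a ^ 2)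

/-- `⟨a,b⟩ = (1+a²+b²)^{1/2}`. -/
def jap2 (a b : ℝ) : ℝ := Real.sqrt (1 + a ^ 2 + b ^ 2)

/-- `⟨1/a⟩ = (1+a⁻²)^{1/2}`. -/
def japInv (a : ℝ) : ℝ := Real.sqrt (1 + (a⁻¹) ^ 2)

/-- `λ(k) = min(1, |k|^{2/3})`. -/
def lamED (k : ℝ) : ℝ := min 1 (|k| ^ ((2:ℝ)/3))

/-- Fourier transform on `ℝ²`. -/
def FT2 (f : ℝ × ℝ → ℂ) (p : ℝ × ℝ) : ℂ :=
  ∫ q : ℝ × ℝ, Complex.exp (-(((2 * π * (p.1 * q.1 + p.2 * q.2) : ℝ) : ℂ) * Complex.I)) * f q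

/-- Inverse Fourier transform on `ℝ²`. -/
def invFT2 (g : ℝ × ℝ → ℂ) (q : ℝ × ℝ) : ℂ :=
  ∫ p : ℝ × ℝ, Complex.exp (((2 * π * (p.1 * q.1 + p.2 * q.2) : ℝ) : ℂ) * Complex.I) * g p

/-- `L²(ℝ²)` norm. -/
def L2N (g : ℝ × ℝ → ℂ) : ℝ := Real.sqrt (∫ p : ℝ × ℝ, ‖g p‖ ^ 2)

/-- `L¹(ℝ²)` norm. -/
def L1N (g : ℝ × ℝ → ℂ) : ℝ := ∫ p : ℝ × ℝ, ‖g p‖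

/-- `L^p(ℝ²)` norm, `p` a real exponent. -/
def LpN (p : ℝ) (g : ℝ × ℝ → ℂ) : ℝ := (∫ q : ℝ × ℝ, ‖g q‖ ^ p) ^ p⁻¹

/-- Symbol of the Fourier-side transport nonlinearity of the 2D Navier–Stokes equations. -/
def nlSym (k l ξ η : ℝ) : ℝ := (η * (k - l) - l * (ξ - η)) / (l ^ 2 + η ^ 2)

/-- Fourier transform of `-(u·∇ω)` where `u = ∇^⊥(-Δ)⁻¹ω` (Biot–Savart law). -/
def NLF (w : ℝ × ℝ → ℂ) (p : ℝ × ℝ) : ℂ :=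
  ∫ q : ℝ × ℝ, ((nlSym p.1 q.1 p.2 q.2 : ℝ) : ℂ) * w q * w (p.1 - q.1, p.2 - q.2)

/-- Fourier-side formulation of the 2D Navier–Stokes vorticity equation near the Couette flow:
`∂ₜŵ - k ∂_ξ ŵ + ν(k²+ξ²) ŵ = (-(u·∇ω))^`, with initial data `win` (Fourier side). -/
def IsNSCouetteF (ν : ℝ) (win : ℝ × ℝ → ℂ) (w : ℝ → ℝ × ℝ → ℂ) : Prop :=
  (∀ p : ℝ × ℝ, w 0 p = win p) ∧
  ∀ t : ℝ, 0 < t → ∀ k ξ : ℝ,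
    HasDerivAt (fun s => w s (k, ξ))
      ((k : ℂ) * deriv (fun ξ' => w t (k, ξ')) ξ
        - ((ν * (k ^ 2 + ξ ^ 2) : ℝ) : ℂ) * w t (k, ξ)
        + NLF (w t) (k, ξ)) t

/-- Kelvin's explicit solution of the linearized equation, on the Fourier side. -/
def kelvin (ν : ℝ) (win : ℝ × ℝ → ℂ) (t : ℝ) (p : ℝ × ℝ) : ℂ :=
  win (p.1, p.2 + p.1 * t) *
    ((Real.exp (-(ν * ∫ s in (0:ℝ)..t, (p.1 ^ 2 + (p.2 + p.1 * (t - s)) ^ 2))) : ℝ) : ℂ)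

/-- Enhanced dissipation multiplier `𝓜₁`. -/
def M1 (ν k ξ : ℝ) : ℝ :=
  Real.arctan (ν ^ ((1:ℝ)/3) * |k| ^ (-(1:ℝ)/3) * Real.sign k * ξ) + π / 2

/-- Inviscid damping multiplier `𝓜₂`. -/
def M2 (k ξ : ℝ) : ℝ := Real.arctan (ξ / k) + π / 2

/-- Echo multiplier `𝓜₃`. -/
def M3 (κ t k ξ : ℝ) : ℝ :=
  ∫ l : ℝ, japInv l ^ (-(1 + κ)) * (|l| ^ 2)⁻¹ *
    (Real.sign l * Real.arctan ((ξ + t * (k - l)) / (1 + |k - l| + |l|)) + π / 2)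

/-- Dissipation symbol `Υ = (-∂ₜ + k∂_ξ)𝓜₃` of the echo multiplier `𝓜₃`. -/
def Upsilon (κ t k ξ : ℝ) : ℝ :=
  ∫ l : ℝ, japInv l ^ (-(1 + κ)) * |l|⁻¹ *
    ((1 + |k - l| + |l|) / ((1 + |k - l| + |l|) ^ 2 + (ξ + t * (k - l)) ^ 2))

/-- Weight `e^{cν^{1/3}λ(k)t}⟨k⟩⟨1/k⟩^ε`. -/
def edWlam (c ν ε t : ℝ) (p : ℝ × ℝ) : ℝ :=
  Real.exp (c * ν ^ ((1:ℝ)/3) * lamED p.1 * t) * jap p.1 * japInv p.1 ^ ε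

/-- Weight `e^{cν^{1/3}|k|^{2/3}t}⟨k⟩^m⟨1/k⟩^ε`. -/
def edW23 (c ν m ε t : ℝ) (p : ℝ × ℝ) : ℝ :=
  Real.exp (c * ν ^ ((1:ℝ)/3) * |p.1| ^ ((2:ℝ)/3) * t) * jap p.1 ^ m * japInv p.1 ^ ε

end

theorem one_le_japInv (a : ℝ) : 1 ≤ japInv a := by
  unfold japInv
  exact Real.one_le_sqrt.mpr (by nlinarith [sq_nonneg a⁻¹])

theorem inv_abs_le_japInv (a : ℝ) : |a|⁻¹ ≤ japInv a := by
  unfold japInv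
  apply Real.le_sqrt_of_sq_le
  rw [inv_pow, sq_abs, ← inv_pow]
  linarith

theorem japInv_le_japInv {a b : ℝ} (ha : a ≠ 0) (hab : |a| ≤ |b|) : japInv b ≤ japInv a := by
  unfold japInv
  apply Real.sqrt_le_sqrt
  have h : |b|⁻¹ ≤ |a|⁻¹ := inv_anti₀ (abs_pos.mpr ha) hab
  have h2 : |b|⁻¹ ^ 2 ≤ |a|⁻¹ ^ 2 := by gcongr
  simpa only [inv_pow, sq_abs, add_le_add_iff_left] using h2

theorem japInv_le_two_mul_japInv {a b : ℝ} (hb : b ≠ 0) (hab : |b| ≤ 2 * |a|) :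
    japInv a ≤ 2 * japInv b := by
  have h1 : japInv (2 * a) ≤ japInv b :=
    japInv_le_japInv hb (by rwa [abs_mul, abs_of_pos (two_pos : (0:ℝ) < 2)])
  have h2 : japInv a ≤ 2 * japInv (2 * a) := by
    unfold japInv
    apply Real.sqrt_le_iff.mpr ⟨by positivity, ?_⟩
    rw [mul_pow, Real.sq_sqrt (by positivity), mul_inv]
    linarith
  linarith

/-- Transfer of the low-horizontal-frequency singularity in the region `2|k| < |k−l|`:
`|k−l|^{-1/2} ≤ ⟨1/(k−l)⟩^{1/2} ≤ C ⟨1/l⟩^ε ⟨1/(k−l)⟩^ε (1 + ⟨1/k⟩^{1/2−2ε})`. -/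
theorem low_frequency_singularity_transfer (ε : ℝ) (hε0 : 0 < ε) (hε : ε < 1/2) :
    ∃ C : ℝ, 0 < C ∧ ∀ k l : ℝ, k ≠ 0 → 2 * |k| < |k - l| →
      (|k - l| / 2 ≤ |l| ∧ |l| ≤ 2 * |k - l|) ∧
      |k - l| ^ (-(1:ℝ)/2) ≤ japInv (k - l) ^ ((1:ℝ)/2) ∧
      japInv (k - l) ^ ((1:ℝ)/2) ≤
        C * japInv l ^ ε * japInv (k - l) ^ ε * (1 + japInv k ^ ((1:ℝ)/2 - 2 * ε)) := by
  refine ⟨2 ^ ε, by positivity, fun k l hk hkl => ?_⟩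
  have hk0 : 0 < |k| := abs_pos.mpr hk
  have hm : 0 < |k - l| := by linarith
  have hl1 : |k - l| / 2 ≤ |l| := by linarith [abs_sub k l]
  have hl2 : |l| ≤ 2 * |k - l| := by
    have h := abs_sub k (k - l)
    rw [sub_sub_cancel] at h
    linarith
  have hl : l ≠ 0 := abs_pos.mp (by linarith)
  have hA := one_le_japInv (k - l)
  have hA0 : 0 < japInv (k - l) := by linarith
  have hB0 : 0 < japInv l := by linarith [one_le_japInv l]
  have hK0 : 0 < japInv k := by linarith [one_le_japInv k]
  refine ⟨⟨hl1, hl2⟩, ?_, ?_⟩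
  · rw [neg_div, Real.rpow_neg hm.le, ← Real.inv_rpow hm.le]
    exact Real.rpow_le_rpow (by positivity) (inv_abs_le_japInv _) (by norm_num)
  · have hAB : japInv (k - l) ^ ε ≤ 2 ^ ε * japInv l ^ ε := by
      rw [← Real.mul_rpow zero_le_two hB0.le]
      exact Real.rpow_le_rpow hA0.le (japInv_le_two_mul_japInv hl hl2) hε0.le
    have hAK : japInv (k - l) ^ ((1:ℝ)/2 - 2 * ε) ≤ 1 + japInv k ^ ((1:ℝ)/2 - 2 * ε) := by
      rcases le_total 0 ((1:ℝ)/2 - 2 * ε) with h | h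
      · have := Real.rpow_le_rpow hA0.le (japInv_le_japInv hk (by linarith : |k| ≤ |k - l|)) h
        linarith
      · have := Real.rpow_le_one_of_one_le_of_nonpos hA h
        have := Real.rpow_nonneg hK0.le ((1:ℝ)/2 - 2 * ε)
        linarith
    calc japInv (k - l) ^ ((1:ℝ)/2)
        = japInv (k - l) ^ ε * japInv (k - l) ^ ε * japInv (k - l) ^ ((1:ℝ)/2 - 2 * ε) := by
          rw [← Real.rpow_add hA0, ← Real.rpow_add hA0]
          congr 1
          ring
      _ ≤ 2 ^ ε * japInv l ^ ε * japInv (k - l) ^ ε *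
            (1 + japInv k ^ ((1:ℝ)/2 - 2 * ε)) := by
          gcongr
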